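/- Let f be a real differentiable function on (a,b) with f' monotonic and |f'(x)| ≤ θ < 1. Then Σ_{a < n ≤ b} e(f(n)) = ∫_a^b e(f(x)) dx + O(1), where e(u) = e^{2πiu} and the implied constant depends only on θ. -/

import Mathlib

open Complex Set

/-- e(u) = e^{2πiu}. -/
noncomputable def e (u : ℝ) : ℂ := Complex.exp (2 * Real.pi * Complex.I * u)

lemma norm_e (u : ℝ) : ‖e u‖ = 1 := by
  rw [e, show 2 * (Real.pi : ℂ) * I * u = ((2 * Real.pi * u : ℝ) : ℂ) * I by push_cast; ring]
  exact Complex.norm_exp_ofReal_mul_I _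

lemma e_add (u v : ℝ) : e (u + v) = e u * e v := by
  rw [e, e, e, ← Complex.exp_add]
  push_cast
  ring_nf

lemma continuous_e : Continuous e := by
  unfold e
  fun_prop

lemma norm_e_sub_e_le (u v : ℝ) : ‖e u - e v‖ ≤ 2 * Real.pi * |u - v| := by
  have h1 : e u - e v = e v * (e (u - v) - 1) := by
    rw [mul_sub, ← e_add]
    simp
  have h2 : e (u - v) = Complex.exp (I * ((2 * Real.pi * (u - v) : ℝ) : ℂ)) := by
    rw [e]
    push_cast
    ring_nf
  rw [h1, norm_mul, norm_e, one_mul, h2]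
  refine (Real.norm_exp_I_mul_ofReal_sub_one_le).trans ?_
  rw [Real.norm_eq_abs, abs_mul, abs_of_pos Real.two_pi_pos]

/-- The function `1 / (e α - 1) - 1 / (2πiα)` extends across `α = 0` to a bounded Lipschitz
function on `[-θ, θ]` when `θ < 1`. -/
lemma exists_lipschitz_correction {θ : ℝ} (hθ : θ < 1) :
    ∃ (h : ℝ → ℂ) (H L : ℝ), 0 ≤ H ∧ 0 ≤ L ∧
      (∀ α, |α| ≤ θ → h α * (e α - 1) = 1 - ∫ x in (0 : ℝ)..1, e (α * x)) ∧
      (∀ α, |α| ≤ θ → ‖h α‖ ≤ H) ∧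
      (∀ α β, |α| ≤ θ → |β| ≤ θ → ‖h α - h β‖ ≤ L * |α - β|) := by
  set c : ℂ := 2 * Real.pi * I with hc
  have hc0 : c ≠ 0 := Complex.two_pi_I_ne_zero
  set E : ℂ → ℂ := fun z => Complex.exp (c * z) with hE
  have hEd : Differentiable ℂ E := by
    intro z
    fun_prop
  have hE0 : E 0 = 1 := by simp [hE]
  set φ : ℂ → ℂ := dslope E 0 with hφ
  have hφd : Differentiable ℂ φ := by
    rw [← differentiableOn_univ] at hEd ⊢
    exact (Complex.differentiableOn_dslope Filter.univ_mem).2 hEd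
  have hφ0 : φ 0 = c := by
    rw [hφ, dslope_same]
    have : HasDerivAt E (Complex.exp (c * 0) * (c * 1)) 0 :=
      ((hasDerivAt_id (0 : ℂ)).const_mul c).cexp
    simpa using this.deriv
  have hφmul (z : ℂ) : z * φ z = E z - 1 := by
    have := sub_smul_dslope E 0 z
    rw [hE0] at this
    simpa using this
  set G : ℂ → ℂ := fun z => 1 - φ z / c with hG
  have hGd : Differentiable ℂ G := by
    intro z
    have := hφd z
    fun_prop
  have hG0 : G 0 = 0 := by simp [hG, hφ0, hc0]
  set χ : ℂ → ℂ := dslope G 0 with hχ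
  have hχd : Differentiable ℂ χ := by
    rw [← differentiableOn_univ] at hGd ⊢
    exact (Complex.differentiableOn_dslope Filter.univ_mem).2 hGd
  have hχmul (z : ℂ) : z * χ z = G z := by
    have := sub_smul_dslope G 0 z
    rw [hG0] at this
    simpa using this
  have hφne (α : ℝ) (hα : |α| ≤ θ) : φ α ≠ 0 := by
    intro h0
    by_cases hα0 : α = 0
    · subst hα0
      exact hc0 (by rw [← hφ0]; simpa using h0)
    have h1 : E α = 1 := by
      have := hφmul α
      rw [h0, mul_zero] at this
      exact (sub_eq_zero.1 this.symm)
    obtain ⟨n, hn⟩ := Complex.exp_eq_one_iff.1 h1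
    have h2 : (α : ℂ) = n := by
      rw [← hc, mul_comm] at hn
      exact mul_right_cancel₀ hc0 hn
    have h3 : α = n := by exact_mod_cast h2
    have h4 : |(n : ℝ)| < 1 := by
      rw [← h3]
      linarith
    have h5 : |n| < 1 := by exact_mod_cast h4
    rw [Int.abs_lt_one_iff] at h5
    exact hα0 (by rw [h3, h5]; simp)
  set h : ℝ → ℂ := fun α => χ α / φ α with hh
  have hhC : ContDiffOn ℝ 1 h (Icc (-θ) θ) := by
    have hχc : ContDiff ℝ 1 (fun α : ℝ => χ α) :=
      (hχd.contDiff.restrict_scalars ℝ).comp Complex.ofRealCLM.contDiff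
    have hφc : ContDiff ℝ 1 (fun α : ℝ => φ α) :=
      (hφd.contDiff.restrict_scalars ℝ).comp Complex.ofRealCLM.contDiff
    simp only [hh, div_eq_mul_inv]
    exact hχc.contDiffOn.mul (hφc.contDiffOn.inv fun α hα => hφne α (abs_le.2 hα))
  obtain ⟨L, hL⟩ := hhC.exists_lipschitzOnWith one_ne_zero (convex_Icc _ _) isCompact_Icc
  obtain ⟨H, hH⟩ := isCompact_Icc.exists_bound_of_continuousOn hhC.continuousOn
  refine ⟨h, max H 0, L, le_max_right _ _, L.2, ?_, ?_, ?_⟩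
  · intro α hα
    have hI : ∫ x in (0 : ℝ)..1, e (α * x) = φ α / c := by
      by_cases hα0 : α = 0
      · subst hα0
        simp [hφ0, hc0, e]
      have hα1 : (α : ℂ) ≠ 0 := by exact_mod_cast hα0
      have : ∀ x : ℝ, e (α * x) = Complex.exp ((c * α) * x) := by
        intro x
        rw [e, hc]
        push_cast
        ring_nf
      simp_rw [this]
      rw [integral_exp_mul_complex (mul_ne_zero hc0 hα1), div_eq_div_iff (mul_ne_zero hc0 hα1) hc0]
      have := hφmul α
      simp only [hE] at this
      simp only [ofReal_one, mul_one, ofReal_zero, mul_zero, Complex.exp_zero]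
      rw [← this]
      ring
    have he : e α - 1 = α * φ α := by
      rw [hφmul]
      rfl
    rw [hI, he]
    have := hχmul α
    have hne := hφne α hα
    simp only [hG] at this
    rw [← this, hh]
    field_simp
  · intro α hα
    exact (hH α (abs_le.1 hα)).trans (le_max_left _ _)
  · intro α β hα hβ
    simpa [dist_eq_norm] using hL.dist_le_mul α (abs_le.1 hα) β (abs_le.1 hβ)

lemma norm_e_sub_integral_sub_le {f : ℝ → ℝ} {s α δ H : ℝ} {w : ℂ}
    (hf : ContinuousOn f (Icc s (s + 1)))
    (hδ : ∀ x ∈ Icc s (s + 1), |f x - (f s + α * (x - s))| ≤ δ)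
    (hw : w * (e α - 1) = 1 - ∫ x in (0 : ℝ)..1, e (α * x)) (hH : ‖w‖ ≤ H) :
    ‖e (f s) - (∫ x in s..s + 1, e (f x)) - (e (f (s + 1)) - e (f s)) * w‖
      ≤ 2 * Real.pi * δ * (1 + H) := by
  have hlin : ∫ x in s..s + 1, e (f s + α * (x - s)) = e (f s) * ∫ x in (0 : ℝ)..1, e (α * x) := by
    simp_rw [e_add]
    rw [intervalIntegral.integral_const_mul,
      intervalIntegral.integral_comp_sub_right (fun x => e (α * x)) s]
    simp
  have hi1 : IntervalIntegrable (fun x => e (f x)) MeasureTheory.volume s (s + 1) := by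
    apply ContinuousOn.intervalIntegrable
    rw [uIcc_of_le (by linarith)]
    exact continuous_e.comp_continuousOn hf
  have hi2 : IntervalIntegrable (fun x => e (f s + α * (x - s))) MeasureTheory.volume s (s + 1) :=
    (continuous_e.comp (by fun_prop)).intervalIntegrable _ _
  have key : e (f s) - (∫ x in s..s + 1, e (f x)) - (e (f (s + 1)) - e (f s)) * w
      = -(∫ x in s..s + 1, (e (f x) - e (f s + α * (x - s))))
        - (e (f (s + 1)) - e (f s + α * (s + 1 - s))) * w := by
    rw [intervalIntegral.integral_sub hi1 hi2, hlin, show α * (s + 1 - s) = α by ring, e_add]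
    linear_combination (-e (f s)) * hw
  have hb1 : ‖∫ x in s..s + 1, (e (f x) - e (f s + α * (x - s)))‖ ≤ 2 * Real.pi * δ := by
    have := intervalIntegral.norm_integral_le_of_norm_le_const (a := s) (b := s + 1)
      (f := fun x => e (f x) - e (f s + α * (x - s))) (C := 2 * Real.pi * δ) (by
        intro x hx
        rw [uIoc_of_le (by linarith)] at hx
        exact (norm_e_sub_e_le _ _).trans
          (mul_le_mul_of_nonneg_left (hδ x ⟨hx.1.le, hx.2⟩) Real.two_pi_pos.le))
    simpa using this
  have hb2 : ‖e (f (s + 1)) - e (f s + α * (s + 1 - s))‖ ≤ 2 * Real.pi * δ :=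
    (norm_e_sub_e_le _ _).trans
      (mul_le_mul_of_nonneg_left (hδ (s + 1) ⟨by linarith, le_rfl⟩) Real.two_pi_pos.le)
  rw [key]
  calc _ ≤ _ := norm_sub_le _ _
    _ ≤ 2 * Real.pi * δ + 2 * Real.pi * δ * H := by
        rw [norm_neg, norm_mul]
        have := (norm_nonneg _).trans hb2
        gcongr
    _ = _ := by ring

lemma norm_sum_sub_mul_le {z w : ℕ → ℂ} {H : ℝ} (K : ℕ) (hz : ∀ k, ‖z k‖ ≤ 1)
    (hw : ∀ k ≤ K, ‖w k‖ ≤ H) :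
    ‖∑ k ∈ Finset.range K, (z (k + 1) - z k) * w k‖
      ≤ 2 * H + ∑ k ∈ Finset.range K, ‖w (k + 1) - w k‖ := by
  have key : ∑ k ∈ Finset.range K, (z (k + 1) - z k) * w k
      = z K * w K - z 0 * w 0 - ∑ k ∈ Finset.range K, z (k + 1) * (w (k + 1) - w k) := by
    rw [← Finset.sum_range_sub (fun k => z k * w k), ← Finset.sum_sub_distrib]
    exact Finset.sum_congr rfl fun k _ => by ring
  have hb (k : ℕ) (u : ℂ) : ‖z k * u‖ ≤ ‖u‖ := by
    rw [norm_mul]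
    exact mul_le_of_le_one_left (norm_nonneg _) (hz k)
  rw [key]
  have h1 := norm_sub_le (z K * w K - z 0 * w 0)
    (∑ k ∈ Finset.range K, z (k + 1) * (w (k + 1) - w k))
  have h2 := norm_sub_le (z K * w K) (z 0 * w 0)
  have h3 : ‖∑ k ∈ Finset.range K, z (k + 1) * (w (k + 1) - w k)‖
      ≤ ∑ k ∈ Finset.range K, ‖w (k + 1) - w k‖ :=
    norm_sum_le_of_le _ fun k _ => hb _ _
  linarith [hb K (w K), hb 0 (w 0), hw K le_rfl, hw 0 (Nat.zero_le _)]

/-- A monotone or antitone function on `s` varies less over a shorter interval with the same left end. -/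
lemma abs_sub_le_abs_sub_of_monotoneOn_or_antitoneOn {g : ℝ → ℝ} {s : Set ℝ}
    (hg : MonotoneOn g s ∨ AntitoneOn g s) {x y z : ℝ} (hx : x ∈ s) (hy : y ∈ s) (hz : z ∈ s)
    (hxy : x ≤ y) (hyz : y ≤ z) : |g y - g x| ≤ |g z - g x| := by
  rcases hg with hg | hg
  · have h1 := hg hx hy hxy
    have h2 := hg hy hz hyz
    rw [abs_of_nonneg (by linarith), abs_of_nonneg (by linarith)]
    linarith
  · have h1 := hg hx hy hxy
    have h2 := hg hy hz hyz
    rw [abs_of_nonpos (by linarith), abs_of_nonpos (by linarith)]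
    linarith

lemma sum_abs_sub_of_monotoneOn_or_antitoneOn {g : ℝ → ℝ} {c : ℝ} {K : ℕ}
    (hg : MonotoneOn g (Icc c (c + K)) ∨ AntitoneOn g (Icc c (c + K))) :
    ∑ k ∈ Finset.range K, |g (c + (k + 1 : ℕ)) - g (c + k)| = |g (c + K) - g c| := by
  have hmem (k : ℕ) (hk : k ≤ K) : c + (k : ℝ) ∈ Icc c (c + K) := by
    have : (k : ℝ) ≤ K := by exact_mod_cast hk
    exact ⟨by linarith [k.cast_nonneg (α := ℝ)], by linarith⟩
  have hle (k : ℕ) : c + (k : ℝ) ≤ c + (k + 1 : ℕ) := by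
    push_cast
    linarith
  have hc : c ∈ Icc c (c + K) := by simp
  have hcK := (hmem K le_rfl).1
  have htel := Finset.sum_range_sub (fun k : ℕ => g (c + k)) K
  simp only [Nat.cast_zero, add_zero] at htel
  rcases hg with hg | hg
  · rw [abs_of_nonneg (sub_nonneg.2 (hg hc (hmem K le_rfl) hcK)), ← htel]
    refine Finset.sum_congr rfl fun k hk => abs_of_nonneg (sub_nonneg.2 ?_)
    have hk := Finset.mem_range.1 hk
    exact hg (hmem k hk.le) (hmem (k + 1) hk) (hle k)
  · rw [abs_of_nonpos (sub_nonpos.2 (hg hc (hmem K le_rfl) hcK)), ← htel, ← Finset.sum_neg_distrib]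
    refine Finset.sum_congr rfl fun k hk => abs_of_nonpos (sub_nonpos.2 ?_)
    have hk := Finset.mem_range.1 hk
    exact hg (hmem k hk.le) (hmem (k + 1) hk) (hle k)

lemma abs_sub_linear_le {f f' : ℝ → ℝ} {s δ : ℝ}
    (hf : ∀ x ∈ Icc s (s + 1), HasDerivAt f (f' x) x)
    (hδ : ∀ x ∈ Icc s (s + 1), |f' x - f' s| ≤ δ) :
    ∀ x ∈ Icc s (s + 1), |f x - (f s + f' s * (x - s))| ≤ δ := by
  intro x hx
  have hs : s ∈ Icc s (s + 1) := ⟨le_rfl, by linarith⟩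
  have h := (convex_Icc s (s + 1)).norm_image_sub_le_of_norm_hasDerivWithin_le
    (f := fun y => f y - f' s * (y - s)) (f' := fun y => f' y - f' s) (C := δ)
    (fun y hy => by
      have := (hf y hy).fun_sub (((hasDerivAt_id' y).sub_const s).const_mul (f' s))
      rw [mul_one] at this
      exact this.hasDerivWithinAt) hδ hs hx
  have hδ0 : 0 ≤ δ := (abs_nonneg _).trans (hδ s hs)
  simp only [Real.norm_eq_abs, sub_self, mul_zero, sub_zero] at h
  rw [abs_of_nonneg (sub_nonneg.2 hx.1)] at h
  calc _ = |f x - f' s * (x - s) - f s| := by ring_nf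
    _ ≤ _ := h
    _ ≤ δ * 1 := by
        gcongr
        linarith [hx.2]
    _ = δ := mul_one _

lemma exists_norm_sum_range_sub_integral_le {θ : ℝ} (hθ : θ < 1) :
    ∃ C : ℝ, ∀ (c : ℝ) (K : ℕ) (f f' : ℝ → ℝ),
      (∀ x ∈ Icc c (c + K), HasDerivAt f (f' x) x) →
      (MonotoneOn f' (Icc c (c + K)) ∨ AntitoneOn f' (Icc c (c + K))) →
      (∀ x ∈ Icc c (c + K), |f' x| ≤ θ) →
      ‖(∑ k ∈ Finset.range K, e (f (c + k))) - ∫ x in c..c + K, e (f x)‖ ≤ C := by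
  obtain ⟨h, H, L, hH0, hL0, hh, hH, hL⟩ := exists_lipschitz_correction hθ
  refine ⟨2 * Real.pi * (2 * θ) * (1 + H) + (2 * H + L * (2 * θ)), ?_⟩
  intro c K f f' hf hmono hbd
  have hmem (k : ℕ) (hk : k ≤ K) : c + (k : ℝ) ∈ Icc c (c + K) := by
    have : (k : ℝ) ≤ K := by exact_mod_cast hk
    exact ⟨by linarith [k.cast_nonneg (α := ℝ)], by linarith⟩
  have hsucc (k : ℕ) : c + ((k + 1 : ℕ) : ℝ) = c + k + 1 := by
    push_cast
    ring
  have hsub (k : ℕ) (hk : k < K) : Icc (c + (k : ℝ)) (c + k + 1) ⊆ Icc c (c + K) := by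
    rw [← hsucc]
    exact Icc_subset_Icc (hmem k hk.le).1 (hmem (k + 1) hk).2
  have hcont : ContinuousOn f (Icc c (c + K)) := fun x hx =>
    (hf x hx).continuousAt.continuousWithinAt
  have hvar : ∑ k ∈ Finset.range K, |f' (c + (k + 1 : ℕ)) - f' (c + k)| ≤ 2 * θ := by
    rw [sum_abs_sub_of_monotoneOn_or_antitoneOn hmono]
    have h1 := hbd _ (hmem K le_rfl)
    have h2 := hbd c (by simp)
    linarith [abs_sub (f' (c + K)) (f' c)]
  have hint_sum : ∑ k ∈ Finset.range K, ∫ x in c + (k : ℝ)..c + (k + 1 : ℕ), e (f x)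
      = ∫ x in c..c + K, e (f x) := by
    have := intervalIntegral.sum_integral_adjacent_intervals (n := K) (a := fun k : ℕ => c + (k : ℝ))
      (f := fun x => e (f x)) (μ := MeasureTheory.volume) (by
        intro k hk
        apply ContinuousOn.intervalIntegrable
        rw [hsucc, uIcc_of_le (by linarith)]
        exact continuous_e.comp_continuousOn (hcont.mono (hsub k hk)))
    simpa using this
  have hlocal : ∀ k ∈ Finset.range K,
      ‖e (f (c + k)) - (∫ x in c + (k : ℝ)..c + (k + 1 : ℕ), e (f x))
        - (e (f (c + (k + 1 : ℕ))) - e (f (c + k))) * h (f' (c + k))‖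
      ≤ 2 * Real.pi * |f' (c + (k + 1 : ℕ)) - f' (c + k)| * (1 + H) := by
    intro k hk
    have hk := Finset.mem_range.1 hk
    have hkb := hbd _ (hmem k hk.le)
    rw [hsucc]
    refine norm_e_sub_integral_sub_le (hcont.mono (hsub k hk))
      (abs_sub_linear_le (fun x hx => hf x (hsub k hk hx)) fun x hx => ?_) (hh _ hkb) (hH _ hkb)
    exact abs_sub_le_abs_sub_of_monotoneOn_or_antitoneOn hmono (hmem k hk.le) (hsub k hk hx)
      (hsucc k ▸ hmem (k + 1) hk) hx.1 hx.2
  have hlip : ∑ k ∈ Finset.range K, ‖h (f' (c + (k + 1 : ℕ))) - h (f' (c + k))‖ ≤ L * (2 * θ) := by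
    refine le_trans (Finset.sum_le_sum fun k hk => ?_)
      ((Finset.mul_sum _ _ _).symm.trans_le (mul_le_mul_of_nonneg_left hvar hL0))
    have hk := Finset.mem_range.1 hk
    exact hL _ _ (hbd _ (hmem (k + 1) hk)) (hbd _ (hmem k hk.le))
  have hparts := norm_sum_sub_mul_le (z := fun k => e (f (c + k))) (w := fun k => h (f' (c + k))) K
    (fun k => (norm_e _).le) (fun k hk => hH _ (hbd _ (hmem k hk)))
  have hsum := (norm_sum_le_of_le _ hlocal).trans_eq
    (by rw [← Finset.sum_mul, ← Finset.mul_sum])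
  have hsum' := hsum.trans (b := _) (c := 2 * Real.pi * (2 * θ) * (1 + H)) (by
    have := Real.two_pi_pos.le
    gcongr)
  rw [Finset.sum_sub_distrib, Finset.sum_sub_distrib, hint_sum] at hsum'
  have := norm_add_le_of_le hsum' (hparts.trans (add_le_add_right hlip (2 * H)))
  simpa using this

lemma norm_integral_e_le (f : ℝ → ℝ) (u v : ℝ) : ‖∫ x in u..v, e (f x)‖ ≤ |v - u| := by
  simpa using intervalIntegral.norm_integral_le_of_norm_le_const (a := u) (b := v) (C := 1)
    (f := fun x => e (f x)) fun x _ => (norm_e _).le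

lemma intervalIntegrable_e_comp {f : ℝ → ℝ} {a b : ℝ} (hab : a ≤ b)
    (hf : ContinuousOn f (Ioo a b)) :
    IntervalIntegrable (fun x => e (f x)) MeasureTheory.volume a b := by
  rw [intervalIntegrable_iff_integrableOn_Ioo_of_le hab]
  refine MeasureTheory.IntegrableOn.of_bound (by simp)
    ((continuous_e.comp_continuousOn hf).aestronglyMeasurable measurableSet_Ioo) 1 ?_
  exact Filter.Eventually.of_forall fun x => (norm_e _).le

/-- Van der Corput's lemma (Titchmarsh, Lemma 4.8): if f is differentiable on (a,b)
with f' monotonic and |f'| ≤ θ < 1, then Σ_{a<n≤b} e(f(n)) = ∫_a^b e(f(x)) dx + O(1),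
the implied constant depending only on θ. -/
theorem exp_sum_eq_integral_add_O_one (θ : ℝ) (hθ : θ < 1) :
    ∃ C : ℝ, ∀ (a b : ℝ) (f f' : ℝ → ℝ), a ≤ b →
      (∀ x ∈ Ioo a b, HasDerivAt f (f' x) x) →
      (MonotoneOn f' (Ioo a b) ∨ AntitoneOn f' (Ioo a b)) →
      (∀ x ∈ Ioo a b, |f' x| ≤ θ) →
      ‖(∑ n ∈ Finset.Ioc ⌊a⌋ ⌊b⌋, e (f (n : ℝ))) - ∫ x in a..b, e (f x)‖ ≤ C := by
  obtain ⟨C, hC⟩ := exists_norm_sum_range_sub_integral_le hθ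
  refine ⟨max C 0 + 4, ?_⟩
  intro a b f f' hab hf hmono hbd
  have ha1 := Int.floor_le a
  have ha2 := Int.lt_floor_add_one a
  have hb1 := Int.floor_le b
  have hb2 := Int.le_ceil b
  have hb3 := Int.ceil_lt_add_one b
  have hfc : ⌊b⌋ ≤ ⌈b⌉ := Int.floor_le_ceil b
  have hcf : ⌈b⌉ ≤ ⌊b⌋ + 1 := Int.ceil_le_floor_add_one b
  have hcard (m n : ℤ) : ‖∑ k ∈ Finset.Ioc m n, e (f (k : ℝ))‖ ≤ ((n - m).toNat : ℝ) := by
    refine (norm_sum_le_of_le _ fun k _ => (norm_e _).le).trans ?_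
    simp
  rcases lt_or_ge (⌊a⌋ + 1) ⌈b⌉ with hlt | hge
  · obtain ⟨K, hK⟩ := Int.eq_ofNat_of_zero_le (show 0 ≤ ⌈b⌉ - 1 - (⌊a⌋ + 1) by omega)
    have hKr : ((⌊a⌋ + 1 : ℤ) : ℝ) + K = ⌈b⌉ - 1 := by
      have : ((⌈b⌉ - 1 - (⌊a⌋ + 1) : ℤ) : ℝ) = ((K : ℤ) : ℝ) := by rw [hK]
      push_cast at this ⊢
      linarith
    set c : ℝ := ((⌊a⌋ + 1 : ℤ) : ℝ) with hc
    have hac : a < c := by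
      rw [hc]
      push_cast
      exact ha2
    have hca : c ≤ a + 1 := by
      rw [hc]
      push_cast
      linarith
    have hcK : c ≤ c + K := by linarith [K.cast_nonneg (α := ℝ)]
    have hsub : Icc c (c + K) ⊆ Ioo a b := fun x hx => ⟨by linarith [hx.1], by linarith [hx.2]⟩
    have hmain := hC c K f f' (fun x hx => hf x (hsub hx))
      (hmono.imp (·.mono hsub) (·.mono hsub)) (fun x hx => hbd x (hsub hx))
    have hi := intervalIntegrable_e_comp hab
      (fun x hx => (hf x hx).continuousAt.continuousWithinAt)
    have hsub' (u v : ℝ) (hu : a ≤ u) (huv : u ≤ v) (hv : v ≤ b) :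
        IntervalIntegrable (fun x => e (f x)) MeasureTheory.volume u v :=
      hi.mono_set (by rw [uIcc_of_le huv, uIcc_of_le hab]; exact Icc_subset_Icc hu hv)
    have hsplit : ∫ x in a..b, e (f x) = (∫ x in a..c, e (f x)) + (∫ x in c..c + K, e (f x))
        + ∫ x in c + K..b, e (f x) := by
      rw [intervalIntegral.integral_add_adjacent_intervals,
        intervalIntegral.integral_add_adjacent_intervals] <;>
      apply hsub' <;> linarith
    have hsum : ∑ n ∈ Finset.Ioc ⌊a⌋ ⌊b⌋, e (f (n : ℝ)) = ∑ k ∈ Finset.range K, e (f (c + k))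
        + ∑ n ∈ Finset.Ioc (⌈b⌉ - 2) ⌊b⌋, e (f (n : ℝ)) := by
      have h1 : ∑ k ∈ Finset.range K, e (f (c + k))
          = ∑ n ∈ Finset.Ioc ⌊a⌋ (⌈b⌉ - 2), e (f (n : ℝ)) := by
        refine Finset.sum_bij (fun (k : ℕ) _ => ⌊a⌋ + 1 + (k : ℤ)) ?_ ?_ ?_ ?_
        · intro k hk
          simp only [Finset.mem_range, Finset.mem_Ioc] at hk ⊢
          omega
        · intro k _ l _ hkl
          simpa using hkl
        · intro n hn
          simp only [Finset.mem_Ioc] at hn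
          exact ⟨(n - (⌊a⌋ + 1)).toNat, Finset.mem_range.2 (by omega), by omega⟩
        · intro k _
          rw [hc]
          push_cast
          rfl
      rw [h1, ← Finset.sum_union (Finset.disjoint_left.2 fun n hn hn' => by
        simp only [Finset.mem_Ioc] at hn hn'
        omega), Finset.Ioc_union_Ioc_eq_Ioc (by omega) (by omega)]
    have htail : ‖∑ n ∈ Finset.Ioc (⌈b⌉ - 2) ⌊b⌋, e (f (n : ℝ))‖ ≤ 2 := by
      refine (hcard _ _).trans ?_
      have : (⌊b⌋ - (⌈b⌉ - 2)).toNat ≤ 2 := by omega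
      exact_mod_cast this
    have hl : ‖∫ x in a..c, e (f x)‖ ≤ 1 := by
      refine (norm_integral_e_le f a c).trans ?_
      rw [abs_of_nonneg] <;> linarith
    have hr : ‖∫ x in c + K..b, e (f x)‖ ≤ 1 := by
      refine (norm_integral_e_le f _ b).trans ?_
      rw [abs_of_nonneg] <;> linarith
    rw [hsum, hsplit]
    have := norm_sub_le_of_le (norm_sub_le_of_le (norm_add_le_of_le hmain htail) hl) hr
    have hmax := le_max_left C 0
    calc _ = _ := congrArg norm (by ring)
      _ ≤ _ := this
      _ ≤ _ := by linarith
  · have h1 : ‖∑ n ∈ Finset.Ioc ⌊a⌋ ⌊b⌋, e (f (n : ℝ))‖ ≤ 1 := by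
      refine (hcard _ _).trans ?_
      have : (⌊b⌋ - ⌊a⌋).toNat ≤ 1 := by omega
      exact_mod_cast this
    have h2 : ‖∫ x in a..b, e (f x)‖ ≤ 1 := by
      refine (norm_integral_e_le f a b).trans ?_
      have : (⌈b⌉ : ℝ) ≤ ⌊a⌋ + 1 := by exact_mod_cast hge
      rw [abs_of_nonneg] <;> linarith
    linarith [norm_sub_le_of_le h1 h2, le_max_right C 0]
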